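/- (Discrete fractional Grönwall inequality, H¹ form.) Let 0 < α < 1, ν ∈ [0,1/2), and let the kernels A^{(n,ν)}_{n−k} on a mesh 0 = t_0 < ⋯ < t_N = T satisfy assumptions A1, A2 (with constant π_A) and A3 (with step-ratio bound ρ). Let (g^n)_{n=1}^N and (λ_l)_{l=0}^{N−1} be nonnegative sequences, and let Λ ≥ Σ_{l=0}^{N−1} λ_l be a constant. Assume the maximum step τ := max_k τ_k satisfies τ ≤ (2 π_A Γ(2−α) Λ)^{−1/α}. If a nonnegative sequence (v^k)_{k=0}^N satisfies Σ_{k=1}^n A^{(n,ν)}_{n−k} (v^k − v^{k−1}) ≤ Σ_{k=1}^n λ_{n−k} v^{k−ν} + g^n for all 1 ≤ n ≤ N, then for all 1 ≤ n ≤ N: v^n ≤ 2 E_α(2 max{1,ρ} π_A Λ t_n^α) ( v^0 + max_{1≤k≤n} Σ_{j=1}^k P^{(k,ν)}_{k−j} g^j ) ≤ 2 E_α(2 max{1,ρ} π_A Λ t_n^α) ( v^0 + π_A Γ(1−α) max_{1≤k≤n} { t_k^α g^k } ). -/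

import Mathlib

theorem aux_beta (α β a : ℝ) (hα1 : α < 1) (hβ : 0 < β) (ha : 0 < a) :
    ∫ s in (0:ℝ)..a, (a - s) ^ (-α) * s ^ (β - 1) =
      a ^ (β - α) * (Real.Gamma (1 - α) * Real.Gamma β / Real.Gamma (1 + β - α)) := by
  have h := Complex.betaIntegral_scaled (β : ℂ) ((1 - α : ℝ) : ℂ) ha
  rw [Complex.betaIntegral_eq_Gamma_mul_div _ _ (by simpa using hβ) (by simpa using hα1)] at h
  have e : (β : ℂ) + ((1 - α : ℝ) : ℂ) = ((1 + β - α : ℝ) : ℂ) := by push_cast; ring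
  have e2 : (β : ℂ) + ((1 - α : ℝ) : ℂ) - 1 = ((β - α : ℝ) : ℂ) := by push_cast; ring
  rw [e2, e, Complex.Gamma_ofReal, Complex.Gamma_ofReal, Complex.Gamma_ofReal,
    ← Complex.ofReal_cpow ha.le] at h
  have h2 : ∫ x in (0:ℝ)..a, (x : ℂ) ^ ((β : ℂ) - 1) * ((a : ℂ) - x) ^ (((1 - α : ℝ) : ℂ) - 1)
      = ((∫ s in (0:ℝ)..a, (a - s) ^ (-α) * s ^ (β - 1) : ℝ) : ℂ) := by
    rw [← intervalIntegral.integral_ofReal]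
    apply intervalIntegral.integral_congr
    intro x hx
    rw [Set.uIcc_of_le ha.le] at hx
    simp only
    rw [Complex.ofReal_mul, Complex.ofReal_cpow hx.1, Complex.ofReal_cpow (by linarith [hx.2])]
    push_cast
    rw [mul_comm]
    congr 2
    ring
  rw [h2] at h
  have h3 : (∫ s in (0:ℝ)..a, (a - s) ^ (-α) * s ^ (β - 1)) = a ^ (β - α) * (Real.Gamma β * Real.Gamma (1 - α) / Real.Gamma (1 + β - α)) := by
    exact_mod_cast h
  rw [h3, mul_comm (Real.Gamma β)]

theorem aux_beta_int (α β a : ℝ) (hα1 : α < 1) (hβ : 0 < β) (ha : 0 < a) :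
    IntervalIntegrable (fun s => (a - s) ^ (-α) * s ^ (β - 1)) MeasureTheory.volume 0 a := by
  by_contra h
  have h1 := intervalIntegral.integral_undef h
  rw [aux_beta α β a hα1 hβ ha] at h1
  have : 0 < a ^ (β - α) * (Real.Gamma (1 - α) * Real.Gamma β / Real.Gamma (1 + β - α)) := by
    have := Real.Gamma_pos_of_pos (sub_pos.2 hα1)
    have := Real.Gamma_pos_of_pos hβ
    have := Real.Gamma_pos_of_pos (show 0 < 1 + β - α by linarith)
    positivity
  linarith

theorem aux_w_int (α a x y : ℝ) (hα1 : α < 1) :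
    IntervalIntegrable (fun s => (a - s) ^ (-α)) MeasureTheory.volume x y := by
  have := (intervalIntegral.intervalIntegrable_rpow' (r := -α) (a := a - x) (b := a - y)
    (by linarith)).comp_sub_left a
  simpa using this

theorem aux_cheb (w f : ℝ → ℝ) (a b : ℝ) (hab : a < b)
    (hw : MonotoneOn w (Set.Ioo a b)) (hf : AntitoneOn f (Set.Ioo a b))
    (iw : IntervalIntegrable w MeasureTheory.volume a b)
    (jf : IntervalIntegrable f MeasureTheory.volume a b)
    (iwf : IntervalIntegrable (fun s => w s * f s) MeasureTheory.volume a b) :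
    (b - a) * ∫ s in a..b, w s * f s ≤ (∫ s in a..b, w s) * ∫ s in a..b, f s := by
  set W := ∫ s in a..b, w s with hW
  set F := ∫ s in a..b, f s with hF
  set Q := ∫ s in a..b, w s * f s with hQ
  have h1 : ∀ x ∈ Set.Ioo a b, (b - a) * (w x * f x) - (w x * F + f x * W) + Q ≤ 0 := by
    intro x hx
    have : ∫ y in a..b, ((w x * f x) - (w x * f y + f x * w y) + w y * f y) ≤ ∫ y in a..b, (0:ℝ) := by
      apply intervalIntegral.integral_mono_on_of_le_Ioo hab.le
      · exact ((intervalIntegrable_const).sub ((jf.const_mul _).add (iw.const_mul _))).add iwf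
      · exact intervalIntegrable_const
      · intro y hy
        rcases le_total x y with h | h
        · have h2 := hw hx hy h
          have h3 := hf hx hy h
          nlinarith [mul_nonneg (sub_nonneg.2 h2) (sub_nonneg.2 h3)]
        · have h2 := hw hy hx h
          have h3 := hf hy hx h
          nlinarith [mul_nonneg (sub_nonneg.2 h2) (sub_nonneg.2 h3)]
    rw [intervalIntegral.integral_add ((intervalIntegrable_const).sub ((jf.const_mul _).add (iw.const_mul _))) iwf,
      intervalIntegral.integral_sub intervalIntegrable_const ((jf.const_mul _).add (iw.const_mul _)),
      intervalIntegral.integral_add (jf.const_mul _) (iw.const_mul _),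
      intervalIntegral.integral_const, intervalIntegral.integral_zero, smul_eq_mul] at this
    simp only [intervalIntegral.integral_const_mul, ← hW, ← hF, ← hQ] at this
    linarith
  have i1 : IntervalIntegrable (fun x => w x * F + f x * W) MeasureTheory.volume a b :=
    (iw.mul_const _).add (jf.mul_const _)
  have : ∫ x in a..b, ((b - a) * (w x * f x) - (w x * F + f x * W) + Q) ≤ ∫ y in a..b, (0:ℝ) := by
    apply intervalIntegral.integral_mono_on_of_le_Ioo hab.le
    · exact ((iwf.const_mul _).sub i1).add intervalIntegrable_const
    · exact intervalIntegrable_const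
    · exact h1
  rw [intervalIntegral.integral_add ((iwf.const_mul _).sub i1) intervalIntegrable_const,
      intervalIntegral.integral_sub (iwf.const_mul _) i1,
      intervalIntegral.integral_add (iw.mul_const _) (jf.mul_const _),
      intervalIntegral.integral_const_mul, intervalIntegral.integral_mul_const,
      intervalIntegral.integral_mul_const, intervalIntegral.integral_const] at this
  simp only [smul_eq_mul, intervalIntegral.integral_zero, ← hW, ← hF, ← hQ] at this
  nlinarith

theorem aux_ml_summable (α x : ℝ) (hα : 0 < α) :
    Summable (fun i : ℕ => x ^ i / Real.Gamma (1 + (i:ℝ) * α)) := by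
  have hG : ∀ i : ℕ, 0 < Real.Gamma (1 + (i:ℝ) * α) := fun i => Real.Gamma_pos_of_pos (by positivity)
  have key : ∀ i : ℕ, 1 ≤ i → ((i:ℝ) * α) ^ α * Real.Gamma (1 + (i:ℝ) * α) ≤ Real.Gamma (1 + ((i+1 : ℕ):ℝ) * α) := by
    intro i hi
    have hi' : (0:ℝ) < i := by exact_mod_cast hi
    have hp : 0 < (i:ℝ) * α := by positivity
    have h := Real.convexOn_log_Gamma.slope_mono_adjacent (x := (i:ℝ) * α) (y := 1 + (i:ℝ)*α)
      (z := 1 + ((i+1 : ℕ):ℝ) * α) hp (by simp only [Set.mem_Ioi]; positivity) (by linarith) (by push_cast; linarith)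
    simp only [Function.comp_apply] at h
    have e1 : Real.Gamma (1 + (i:ℝ) * α) = (i:ℝ)*α * Real.Gamma ((i:ℝ)*α) := by
      rw [add_comm, Real.Gamma_add_one hp.ne']
    have e2 : (1 + ((i+1 : ℕ):ℝ) * α) - (1 + (i:ℝ)*α) = α := by push_cast; ring
    rw [e2, show 1 + (i:ℝ)*α - i * α = 1 by ring, div_one, le_div_iff₀ hα] at h
    have hl : Real.log (Real.Gamma (1 + (i:ℝ) * α)) - Real.log (Real.Gamma ((i:ℝ)*α)) = Real.log ((i:ℝ)*α) := by
      rw [e1, Real.log_mul hp.ne' (Real.Gamma_pos_of_pos hp).ne']; ring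
    rw [hl] at h
    rw [← Real.log_le_log_iff (by have := hG i; positivity) (hG (i+1)), Real.log_mul (by positivity) (hG i).ne', Real.log_rpow hp]
    linarith
  have ht : Filter.Tendsto (fun i : ℕ => ((i:ℝ) * α) ^ α) Filter.atTop Filter.atTop :=
    (tendsto_rpow_atTop hα).comp (tendsto_natCast_atTop_atTop.atTop_mul_const hα)
  apply summable_of_ratio_norm_eventually_le (r := 1/2) (by norm_num)
  filter_upwards [ht.eventually_ge_atTop (2 * |x|), Filter.eventually_ge_atTop 1] with i h1 h2
  have k := key i h2
  have g1 := hG i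
  have g2 := hG (i+1)
  rw [norm_div, norm_div, norm_pow, norm_pow, Real.norm_eq_abs, Real.norm_of_nonneg g1.le, Real.norm_of_nonneg g2.le,
    ← mul_div_assoc, div_le_div_iff₀ g2 g1]
  have k2 : 2 * |x| * Real.Gamma (1 + (i:ℝ) * α) ≤ Real.Gamma (1 + ((i+1 : ℕ):ℝ) * α) :=
    (mul_le_mul_of_nonneg_right h1 g1.le).trans k
  have := mul_le_mul_of_nonneg_left k2 (show 0 ≤ 1/2 * |x|^i by positivity)
  rw [pow_succ]
  linarith

theorem aux_loc_anti (α β a b c : ℝ) (hα0 : 0 < α) (hα1 : α < 1) (hβ : 0 < β) (hβ1 : β ≤ 1)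
    (ha : 0 ≤ a) (hab : a < b) (hbc : b ≤ c) :
    (b - a) * ∫ s in a..b, (c - s) ^ (-α) * s ^ (β - 1) ≤
      (∫ s in a..b, (c - s) ^ (-α)) * ∫ s in a..b, s ^ (β - 1) := by
  apply aux_cheb (fun s => (c - s) ^ (-α)) (fun s => s ^ (β - 1)) a b hab
  · intro x hx y hy hxy
    simp only
    exact Real.rpow_le_rpow_of_nonpos (by linarith [hy.2]) (by linarith) (by linarith)
  · intro x hx y hy hxy
    simp only
    exact Real.rpow_le_rpow_of_nonpos (by linarith [hx.1]) (by linarith) (by linarith)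
  · exact aux_w_int α c a b hα1
  · exact intervalIntegral.intervalIntegrable_rpow' (by linarith)
  · apply (aux_beta_int α β c hα1 hβ (by linarith)).mono_set
    rw [Set.uIcc_of_le hab.le, Set.uIcc_of_le (by linarith)]
    exact Set.Icc_subset_Icc ha hbc

theorem aux_loc_mono (α β a b c : ℝ) (hα1 : α < 1) (hβ1 : 1 ≤ β)
    (ha : 0 ≤ a) (hab : a < b) (hbc : b ≤ c) :
    ∫ s in a..b, (c - s) ^ (-α) * s ^ (β - 1) ≤
      (∫ s in a..b, (c - s) ^ (-α)) * b ^ (β - 1) := by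
  rw [← intervalIntegral.integral_mul_const]
  apply intervalIntegral.integral_mono_on_of_le_Ioo hab.le
  · apply (aux_beta_int α β c hα1 (by linarith) (by linarith)).mono_set
    rw [Set.uIcc_of_le hab.le, Set.uIcc_of_le (by linarith)]
    exact Set.Icc_subset_Icc ha hbc
  · exact (aux_w_int α c a b hα1).mul_const _
  · intro x hx
    apply mul_le_mul_of_nonneg_left
    · exact Real.rpow_le_rpow (by linarith [hx.1]) hx.2.le (by linarith)
    · exact Real.rpow_nonneg (by linarith [hx.2]) _

theorem aux_tele (f : ℝ → ℝ) (t : ℕ → ℝ) (c : ℝ) (j : ℕ)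
    (hf : ∀ k, k ≤ j → t 0 ≤ t k ∧ t k ≤ c)
    (hi : IntervalIntegrable f MeasureTheory.volume (t 0) c) :
    ∑ k ∈ Finset.Icc 1 j, ∫ s in (t (k-1))..(t k), f s = ∫ s in (t 0)..(t j), f s := by
  induction j with
  | zero => simp
  | succ j ih =>
    rw [Finset.sum_Icc_succ_top (by omega), ih (fun k hk => hf k (by omega)), Nat.add_sub_cancel]
    have h1 := hf j (by omega)
    have h2 := hf (j+1) (by omega)
    apply intervalIntegral.integral_add_adjacent_intervals
    · apply hi.mono_set
      rw [Set.uIcc_of_le h1.1, Set.uIcc_of_le (by linarith)]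
      exact Set.Icc_subset_Icc le_rfl h1.2
    · apply hi.mono_set
      rw [Set.uIcc_of_le (a := t 0) (by linarith)]
      exact Set.uIcc_subset_Icc h1 h2

theorem aux_P_nonneg (N : ℕ) (A P : ℕ → ℕ → ℝ)
    (hA1mono : ∀ n k : ℕ, 2 ≤ k → k ≤ n → n ≤ N → A n (k-1) ≤ A n (k-2) ∧ 0 < A n (k-1))
    (hA1pos : ∀ n : ℕ, 1 ≤ n → n ≤ N → 0 < A n 0)
    (hP0 : ∀ n : ℕ, 1 ≤ n → n ≤ N → P n 0 = 1 / A n 0)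
    (hPrec : ∀ n j : ℕ, 1 ≤ j → j + 1 ≤ n → n ≤ N →
      P n (n-j) = (1 / A j 0) *
        ∑ k ∈ Finset.Icc (j+1) n, (A k (k-j-1) - A k (k-j)) * P n (n-k))
    (n : ℕ) (hnN : n ≤ N) : ∀ d, d < n → 0 ≤ P n d := by
  intro d
  induction d using Nat.strong_induction_on with
  | _ d ih =>
    intro hd
    rcases Nat.eq_zero_or_pos d with h | h
    · subst h
      rw [hP0 n (by omega) hnN]
      exact (one_div_pos.2 (hA1pos n (by omega) hnN)).le
    · have := hPrec n (n-d) (by omega) (by omega) hnN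
      rw [show n - (n-d) = d by omega] at this
      rw [this]
      apply mul_nonneg (one_div_pos.2 (hA1pos _ (by omega) (by omega))).le
      apply Finset.sum_nonneg
      intro k hk
      rw [Finset.mem_Icc] at hk
      apply mul_nonneg _ (ih _ (by omega) (by omega))
      have h2 := (hA1mono k (k-(n-d)+1) (by omega) (by omega) (by omega)).1
      rw [show k-(n-d)+1-1 = k-(n-d) by omega, show k-(n-d)+1-2 = k-(n-d)-1 by omega] at h2
      linarith

theorem aux_P_id (N : ℕ) (A P : ℕ → ℕ → ℝ)
    (hA1pos : ∀ n : ℕ, 1 ≤ n → n ≤ N → 0 < A n 0)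
    (hP0 : ∀ n : ℕ, 1 ≤ n → n ≤ N → P n 0 = 1 / A n 0)
    (hPrec : ∀ n j : ℕ, 1 ≤ j → j + 1 ≤ n → n ≤ N →
      P n (n-j) = (1 / A j 0) *
        ∑ k ∈ Finset.Icc (j+1) n, (A k (k-j-1) - A k (k-j)) * P n (n-k))
    (n : ℕ) (hnN : n ≤ N) : ∀ d, d < n →
      ∑ j ∈ Finset.Icc (n-d) n, P n (n-j) * A j (j-(n-d)) = 1 := by
  intro d
  induction d with
  | zero =>
    intro hd
    have := hA1pos n (by omega) hnN
    simp [hP0 n (by omega) hnN, this.ne']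
  | succ d ih =>
    intro hd
    have ih := ih (by omega)
    obtain ⟨k, hk⟩ : ∃ k, n - (d+1) = k := ⟨_, rfl⟩
    have hk' : n - d = k + 1 := by omega
    rw [hk'] at ih
    rw [hk, ← Finset.add_sum_Ioc_eq_sum_Icc (by omega), hPrec n k (by omega) (by omega) hnN]
    have hA := hA1pos k (by omega) (by omega)
    have e : Finset.Ioc k n = Finset.Icc (k+1) n := by ext; simp
    rw [e, Nat.sub_self, mul_comm, ← mul_assoc, mul_one_div_cancel hA.ne', one_mul,
      ← Finset.sum_add_distrib, ← ih]
    apply Finset.sum_congr rfl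
    intro j hj
    rw [Nat.sub_sub]
    ring

theorem aux_swap (n : ℕ) (f : ℕ → ℕ → ℝ) :
    ∑ j ∈ Finset.Icc 1 n, ∑ k ∈ Finset.Icc 1 j, f j k =
      ∑ k ∈ Finset.Icc 1 n, ∑ j ∈ Finset.Icc k n, f j k := by
  apply Finset.sum_comm'
  intro x y
  simp only [Finset.mem_Icc]
  omega

theorem aux_key (N : ℕ) (α πA ρ β : ℝ)
    (hα0 : 0 < α) (hα1 : α < 1) (hβ : 0 < β) (hπA : 0 < πA)
    (t : ℕ → ℝ) (ht0 : t 0 = 0)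
    (htm : ∀ i j : ℕ, i < j → j ≤ N → t i < t j)
    (A P : ℕ → ℕ → ℝ)
    (hA0 : ∀ j k : ℕ, 1 ≤ k → k ≤ j → j ≤ N → 0 ≤ A j (j-k))
    (hA2 : ∀ n k : ℕ, 1 ≤ k → k ≤ n → n ≤ N →
      (∫ s in (t (k-1))..(t k), (t n - s) ^ (-α)) ≤
        πA * Real.Gamma (1-α) * (t k - t (k-1)) * A n (n-k))
    (hA3 : ∀ k : ℕ, 1 ≤ k → k ≤ N - 1 → (t k - t (k-1)) ≤ ρ * (t (k+1) - t k))
    (m : ℕ) (hm : m + 1 ≤ N)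
    (hP : ∀ d, d < m + 1 → 0 ≤ P (m+1) d)
    (hid : ∀ k, 1 ≤ k → k ≤ m + 1 →
      ∑ j ∈ Finset.Icc k (m+1), P (m+1) (m+1-j) * A j (j-k) = 1) :
    ∑ j ∈ Finset.Icc 1 m, P (m+1) (m+1-j) * (t j ^ (β - α) / Real.Gamma (1 + β - α)) ≤
      πA * max 1 ρ * (t (m+1) ^ β / Real.Gamma (1 + β)) := by
  have hg1 := Real.Gamma_pos_of_pos (sub_pos.2 hα1)
  have hgβ := Real.Gamma_pos_of_pos hβ
  have htn : ∀ k, k ≤ N → 0 ≤ t k := by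
    intro k hk
    rcases Nat.eq_zero_or_pos k with h | h
    · rw [h, ht0]
    · have := htm 0 k h hk; linarith
  have hFk : ∀ a b : ℝ, ∫ s in a..b, s ^ (β - 1) = (b ^ β - a ^ β) / β := by
    intro a b
    rw [integral_rpow (Or.inl (by linarith)), sub_add_cancel]
  have hR0 : (0:ℝ) < max 1 ρ := by positivity
  have hF : ∃ F : ℕ → ℝ, (∀ k, 1 ≤ k → k ≤ m → 0 ≤ F k) ∧
      (∀ j k, 1 ≤ k → k ≤ j → j ≤ m →
        (∫ s in (t (k-1))..(t k), (t j - s) ^ (-α) * s ^ (β - 1)) ≤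
          πA * Real.Gamma (1-α) * A j (j-k) * F k) ∧
      ∑ k ∈ Finset.Icc 1 m, F k ≤ max 1 ρ * (t (m+1) ^ β / β) := by
    rcases le_total β 1 with h1 | h1
    · refine ⟨fun k => (t k ^ β - t (k-1) ^ β) / β, ?_, ?_, ?_⟩
      · intro k hk hkm
        have := htm (k-1) k (by omega) (by omega)
        have := Real.rpow_le_rpow (htn (k-1) (by omega)) this.le hβ.le
        exact div_nonneg (by linarith) hβ.le
      · intro j k hk hkj hjm
        have hlt := htm (k-1) k (by omega) (by omega)
        have hkj' : t k ≤ t j := by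
          rcases hkj.eq_or_lt with h | h
          · rw [h]
          · exact (htm k j h (by omega)).le
        have h2 := aux_loc_anti α β (t (k-1)) (t k) (t j) hα0 hα1 hβ h1 (htn _ (by omega)) hlt hkj'
        rw [hFk] at h2
        have hnn : 0 ≤ (t k ^ β - t (k-1) ^ β) / β := by
          have := Real.rpow_le_rpow (htn (k-1) (by omega)) hlt.le hβ.le
          exact div_nonneg (by linarith) hβ.le
        have h3 := mul_le_mul_of_nonneg_right (hA2 j k hk hkj (by omega)) hnn
        have h4 := h2.trans h3
        rw [← mul_le_mul_iff_right₀ (sub_pos.2 hlt)]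
        linarith
      · have : ∀ q, ∑ k ∈ Finset.Icc 1 q, (t k ^ β - t (k-1) ^ β) / β = t q ^ β / β := by
          intro q
          induction q with
          | zero => simp [ht0, Real.zero_rpow hβ.ne']
          | succ q ih =>
            rw [Finset.sum_Icc_succ_top (by omega), ih, Nat.add_sub_cancel]; ring
        rw [this]
        have h5 : t m ^ β / β ≤ t (m+1) ^ β / β := by
          have := Real.rpow_le_rpow (htn m (by omega)) (htm m (m+1) (by omega) hm).le hβ.le
          gcongr
        have h6 : 0 ≤ t (m+1) ^ β / β := div_nonneg (Real.rpow_nonneg (htn _ hm) _) hβ.le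
        have h7 := mul_le_mul_of_nonneg_right (le_max_left 1 ρ) h6
        linarith
    · refine ⟨fun k => (t k - t (k-1)) * t k ^ (β - 1), ?_, ?_, ?_⟩
      · intro k hk hkm
        have := htm (k-1) k (by omega) (by omega)
        exact mul_nonneg (by linarith) (Real.rpow_nonneg (htn _ (by omega)) _)
      · intro j k hk hkj hjm
        have hlt := htm (k-1) k (by omega) (by omega)
        have hkj' : t k ≤ t j := by
          rcases hkj.eq_or_lt with h | h
          · rw [h]
          · exact (htm k j h (by omega)).le
        have h2 := aux_loc_mono α β (t (k-1)) (t k) (t j) hα1 h1 (htn _ (by omega)) hlt hkj'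
        have h3 := mul_le_mul_of_nonneg_right (hA2 j k hk hkj (by omega))
          (Real.rpow_nonneg (htn k (by omega)) (β - 1))
        linarith
      · have : ∀ q, q ≤ m → ∑ k ∈ Finset.Icc 1 q, (t k - t (k-1)) * t k ^ (β - 1) ≤ max 1 ρ * (t (q+1) ^ β / β) := by
          intro q
          induction q with
          | zero =>
            intro _
            have := Real.rpow_nonneg (htn 1 (by omega)) β
            simp only [zero_add, Finset.Icc_eq_empty_of_lt (Nat.zero_lt_one), Finset.sum_empty]
            positivity
          | succ q ih =>
            intro hq
            have ih := ih (by omega)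
            rw [Finset.sum_Icc_succ_top (by omega), Nat.add_sub_cancel]
            have hlt := htm (q+1) (q+1+1) (by omega) (by omega)
            have h2 : (t (q+1+1) - t (q+1)) * t (q+1) ^ (β - 1) ≤ (t (q+1+1) ^ β - t (q+1) ^ β) / β := by
              rw [← hFk]
              have : ∫ s in (t (q+1))..(t (q+1+1)), t (q+1) ^ (β - 1) ≤ ∫ s in (t (q+1))..(t (q+1+1)), s ^ (β - 1) := by
                apply intervalIntegral.integral_mono_on_of_le_Ioo hlt.le
                · exact intervalIntegrable_const
                · exact intervalIntegral.intervalIntegrable_rpow' (by linarith)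
                · intro x hx
                  exact Real.rpow_le_rpow (htn _ (by omega)) hx.1.le (by linarith)
              rwa [intervalIntegral.integral_const, smul_eq_mul] at this
            have h3 := hA3 (q+1) (by omega) (by omega)
            rw [Nat.add_sub_cancel] at h3
            have hr := Real.rpow_nonneg (htn (q+1) (by omega)) (β - 1)
            have h4 := mul_le_mul_of_nonneg_right h3 hr
            have h5 : 0 ≤ (t (q+1+1) - t (q+1)) * t (q+1) ^ (β - 1) := mul_nonneg (by linarith) hr
            have h6 := mul_le_mul_of_nonneg_right (le_max_right 1 ρ) h5
            have h7 := mul_le_mul_of_nonneg_left h2 hR0.le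
            have h8 : max 1 ρ * ((t (q+1+1) ^ β - t (q+1) ^ β) / β) = max 1 ρ * (t (q+1+1) ^ β / β) - max 1 ρ * (t (q+1) ^ β / β) := by ring
            linarith
        exact this m le_rfl
  obtain ⟨F, hF0, hF1, hF2⟩ := hF
  have hB : ∀ j, 1 ≤ j → j ≤ m → t j ^ (β - α) * (Real.Gamma (1 - α) * Real.Gamma β / Real.Gamma (1 + β - α)) ≤
      ∑ k ∈ Finset.Icc 1 j, πA * Real.Gamma (1-α) * A j (j-k) * F k := by
    intro j hj hjm
    have hp : 0 < t j := by have := htm 0 j hj (by omega); linarith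
    rw [← aux_beta α β (t j) hα1 hβ hp]
    have := aux_tele (fun s => (t j - s) ^ (-α) * s ^ (β - 1)) t (t j) j ?_ ?_
    · rw [ht0] at this
      rw [← this]
      apply Finset.sum_le_sum
      intro k hk
      rw [Finset.mem_Icc] at hk
      exact hF1 j k hk.1 hk.2 hjm
    · intro k hk
      refine ⟨by rw [ht0]; exact htn k (by omega), ?_⟩
      rcases hk.eq_or_lt with h | h
      · rw [h]
      · exact (htm k j h (by omega)).le
    · rw [ht0]
      exact aux_beta_int α β (t j) hα1 hβ hp
  have hC : ∑ j ∈ Finset.Icc 1 m, P (m+1) (m+1-j) * (t j ^ (β - α) * (Real.Gamma (1 - α) * Real.Gamma β / Real.Gamma (1 + β - α)))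
      ≤ πA * Real.Gamma (1-α) * ∑ k ∈ Finset.Icc 1 m, F k := by
    calc _ ≤ ∑ j ∈ Finset.Icc 1 m, ∑ k ∈ Finset.Icc 1 j, P (m+1) (m+1-j) * (πA * Real.Gamma (1-α) * A j (j-k) * F k) := by
          apply Finset.sum_le_sum
          intro j hj
          rw [Finset.mem_Icc] at hj
          rw [← Finset.mul_sum]
          exact mul_le_mul_of_nonneg_left (hB j hj.1 hj.2) (hP _ (by omega))
      _ = ∑ k ∈ Finset.Icc 1 m, πA * Real.Gamma (1-α) * F k * ∑ j ∈ Finset.Icc k m, P (m+1) (m+1-j) * A j (j-k) := by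
          rw [aux_swap]
          apply Finset.sum_congr rfl
          intro k _
          rw [Finset.mul_sum]
          apply Finset.sum_congr rfl
          intro j _
          ring
      _ ≤ _ := by
          rw [Finset.mul_sum]
          apply Finset.sum_le_sum
          intro k hk
          rw [Finset.mem_Icc] at hk
          have h1 := hid k hk.1 (by omega)
          rw [Finset.sum_Icc_succ_top (by omega)] at h1
          have h2 : 0 ≤ P (m+1) (m+1-(m+1)) * A (m+1) (m+1-k) :=
            mul_nonneg (hP _ (by omega)) (hA0 _ _ hk.1 (by omega) hm)
          have h3 : ∑ j ∈ Finset.Icc k m, P (m+1) (m+1-j) * A j (j-k) ≤ 1 := by linarith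
          have h4 : 0 ≤ πA * Real.Gamma (1-α) * F k := mul_nonneg (by positivity) (hF0 k hk.1 hk.2)
          exact mul_le_of_le_one_right h4 h3
  have hD := hC.trans (mul_le_mul_of_nonneg_left hF2 (show 0 ≤ πA * Real.Gamma (1-α) by positivity))
  have hE : ∑ j ∈ Finset.Icc 1 m, P (m+1) (m+1-j) * (t j ^ (β - α) * (Real.Gamma (1 - α) * Real.Gamma β / Real.Gamma (1 + β - α)))
      = (Real.Gamma (1 - α) * Real.Gamma β) * ∑ j ∈ Finset.Icc 1 m, P (m+1) (m+1-j) * (t j ^ (β - α) / Real.Gamma (1 + β - α)) := by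
    rw [Finset.mul_sum]
    apply Finset.sum_congr rfl
    intro j _
    ring
  rw [hE] at hD
  have hpp : 0 < Real.Gamma (1 - α) * Real.Gamma β := by positivity
  rw [← mul_le_mul_iff_right₀ hpp]
  refine hD.trans (le_of_eq ?_)
  rw [add_comm 1 β, Real.Gamma_add_one hβ.ne']
  field_simp

theorem aux_gron (N : ℕ) (ν Λ : ℝ) (hν0 : 0 ≤ ν) (hν1 : ν < 1/2) (hΛ0 : 0 < Λ)
    (A P : ℕ → ℕ → ℝ) (E g lam v : ℕ → ℝ)
    (hA : ∀ n, 1 ≤ n → n ≤ N → 2 * Λ ≤ A n 0)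
    (hP0 : ∀ n : ℕ, 1 ≤ n → n ≤ N → P n 0 = 1 / A n 0)
    (hP : ∀ n, n ≤ N → ∀ d, d < n → 0 ≤ P n d)
    (hid : ∀ n, n ≤ N → ∀ k, 1 ≤ k → k ≤ n →
      ∑ j ∈ Finset.Icc k n, P n (n-j) * A j (j-k) = 1)
    (hE1 : ∀ k, k ≤ N → 1 ≤ E k)
    (hEm : ∀ i j, i ≤ j → j ≤ N → E i ≤ E j)
    (hE : ∀ m, m + 1 ≤ N → 2 * Λ * ∑ j ∈ Finset.Icc 1 m, P (m+1) (m+1-j) * E j ≤ E (m+1) - 1)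
    (hlam : ∀ l : ℕ, l ≤ N - 1 → 0 ≤ lam l)
    (hΛ : ∑ l ∈ Finset.range N, lam l ≤ Λ)
    (hv : ∀ k : ℕ, k ≤ N → 0 ≤ v k)
    (hineq : ∀ n : ℕ, 1 ≤ n → n ≤ N →
      ∑ k ∈ Finset.Icc 1 n, A n (n-k) * (v k - v (k-1)) ≤
        ∑ k ∈ Finset.Icc 1 n, lam (n-k) * (ν * v (k-1) + (1-ν) * v k) + g n)
    (G : ℝ) (hG0 : v 0 ≤ G) :
    ∀ n, n ≤ N → (∀ k, 1 ≤ k → k ≤ n → v 0 + ∑ j ∈ Finset.Icc 1 k, P k (k-j) * g j ≤ G) →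
      v n ≤ 2 * E n * G := by
  have hGn : 0 ≤ G := (hv 0 (by omega)).trans hG0
  have hconv : ∀ j M, 1 ≤ j → j ≤ N → 0 ≤ M → (∀ i, i ≤ j → v i ≤ M) →
      ∑ k ∈ Finset.Icc 1 j, lam (j-k) * (ν * v (k-1) + (1-ν) * v k) ≤ Λ * M := by
    intro j M hj hjN hM hvM
    have h1 : ∑ k ∈ Finset.Icc 1 j, lam (j-k) * (ν * v (k-1) + (1-ν) * v k) ≤
        ∑ k ∈ Finset.Icc 1 j, lam (j-k) * M := by
      apply Finset.sum_le_sum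
      intro k hk
      rw [Finset.mem_Icc] at hk
      apply mul_le_mul_of_nonneg_left _ (hlam _ (by omega))
      have a1 := mul_le_mul_of_nonneg_left (hvM (k-1) (by omega)) hν0
      have a2 := mul_le_mul_of_nonneg_left (hvM k (by omega)) (show 0 ≤ 1 - ν by linarith)
      linarith
    have h2 : ∑ k ∈ Finset.Icc 1 j, lam (j-k) = ∑ l ∈ Finset.range j, lam l := by
      refine Finset.sum_nbij' (fun k => j - k) (fun l => j - l) ?_ ?_ ?_ ?_ ?_ <;>
        simp only [Finset.mem_Icc, Finset.mem_range] <;> intros <;> first | trivial | omega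
    have h3 : ∑ l ∈ Finset.range j, lam l ≤ ∑ l ∈ Finset.range N, lam l := by
      apply Finset.sum_le_sum_of_subset_of_nonneg
      · exact Finset.range_mono hjN
      · intro i hi _
        rw [Finset.mem_range] at hi
        exact hlam i (by omega)
    rw [← Finset.sum_mul, h2] at h1
    exact h1.trans (mul_le_mul_of_nonneg_right (h3.trans hΛ) hM)
  intro n
  induction n using Nat.strong_induction_on with
  | _ n ih =>
    intro hnN hS
    have ih' : ∀ k, k < n → v k ≤ 2 * E k * G := fun k hk =>
      ih k hk (by omega) (fun i h1 h2 => hS i h1 (by omega))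
    by_cases hmax : ∃ k, k < n ∧ v n ≤ v k
    · obtain ⟨k, hk, hvk⟩ := hmax
      have h1 := ih' k hk
      have h2 := mul_le_mul_of_nonneg_right (hEm k n hk.le hnN) hGn
      linarith
    · push Not at hmax
      rcases n with _ | m
      · have h2 := mul_le_mul_of_nonneg_right (hE1 0 hnN) hGn
        linarith
      have hvm : ∀ i, i ≤ m + 1 → v i ≤ v (m+1) := by
        intro i hi
        rcases hi.eq_or_lt with h | h
        · rw [h]
        · exact (hmax i h).le
      have hlhs : ∑ j ∈ Finset.Icc 1 (m+1), P (m+1) (m+1-j) * ∑ k ∈ Finset.Icc 1 j, A j (j-k) * (v k - v (k-1)) = v (m+1) - v 0 := by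
        simp_rw [Finset.mul_sum]
        rw [aux_swap]
        have : ∀ k ∈ Finset.Icc 1 (m+1), ∑ j ∈ Finset.Icc k (m+1), P (m+1) (m+1-j) * (A j (j-k) * (v k - v (k-1))) = v k - v (k-1) := by
          intro k hk
          rw [Finset.mem_Icc] at hk
          simp_rw [← mul_assoc]
          rw [← Finset.sum_mul, hid (m+1) hnN k hk.1 hk.2, one_mul]
        rw [Finset.sum_congr rfl this]
        have : ∀ q, ∑ k ∈ Finset.Icc 1 q, (v k - v (k-1)) = v q - v 0 := by
          intro q
          induction q with
          | zero => simp
          | succ q ih =>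
            rw [Finset.sum_Icc_succ_top (by omega), ih, Nat.add_sub_cancel]; ring
        exact this _
      have hrhs : ∑ j ∈ Finset.Icc 1 (m+1), P (m+1) (m+1-j) * ∑ k ∈ Finset.Icc 1 j, A j (j-k) * (v k - v (k-1))
          ≤ ∑ j ∈ Finset.Icc 1 (m+1), P (m+1) (m+1-j) * (∑ k ∈ Finset.Icc 1 j, lam (j-k) * (ν * v (k-1) + (1-ν) * v k))
            + ∑ j ∈ Finset.Icc 1 (m+1), P (m+1) (m+1-j) * g j := by
        rw [← Finset.sum_add_distrib]
        apply Finset.sum_le_sum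
        intro j hj
        rw [Finset.mem_Icc] at hj
        rw [← mul_add]
        exact mul_le_mul_of_nonneg_left (hineq j hj.1 (by omega)) (hP _ hnN _ (by omega))
      have hlast : P (m+1) (m+1-(m+1)) * (∑ k ∈ Finset.Icc 1 (m+1), lam (m+1-k) * (ν * v (k-1) + (1-ν) * v k)) ≤ v (m+1) / 2 := by
        have h1 := hconv (m+1) (v (m+1)) (by omega) hnN (hv _ hnN) hvm
        have hA' := hA (m+1) (by omega) hnN
        rw [Nat.sub_self, hP0 (m+1) (by omega) hnN, one_div, inv_mul_le_iff₀ (by linarith)]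
        have := mul_le_mul_of_nonneg_right hA' (hv _ hnN)
        linarith
      have hfirst : ∑ j ∈ Finset.Icc 1 m, P (m+1) (m+1-j) * (∑ k ∈ Finset.Icc 1 j, lam (j-k) * (ν * v (k-1) + (1-ν) * v k)) ≤ (E (m+1) - 1) * G := by
        have : ∑ j ∈ Finset.Icc 1 m, P (m+1) (m+1-j) * (∑ k ∈ Finset.Icc 1 j, lam (j-k) * (ν * v (k-1) + (1-ν) * v k))
            ≤ ∑ j ∈ Finset.Icc 1 m, P (m+1) (m+1-j) * (Λ * (2 * E j * G)) := by
          apply Finset.sum_le_sum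
          intro j hj
          rw [Finset.mem_Icc] at hj
          apply mul_le_mul_of_nonneg_left _ (hP _ hnN _ (by omega))
          have hEj := hE1 j (by omega)
          apply hconv j _ hj.1 (by omega) (by positivity)
          intro i hi
          have h1 := ih' i (by omega)
          have h2 := mul_le_mul_of_nonneg_right (hEm i j hi (by omega)) hGn
          linarith
        refine this.trans ?_
        have h2 := mul_le_mul_of_nonneg_right (hE m hnN) hGn
        refine le_trans (le_of_eq ?_) h2
        rw [Finset.mul_sum, Finset.sum_mul]
        apply Finset.sum_congr rfl
        intro j _
        ring
      have hSm := hS (m+1) (by omega) le_rfl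
      rw [hlhs, Finset.sum_Icc_succ_top (by omega)] at hrhs
      linarith

/-- Discrete fractional Grönwall inequality in its H¹ form, with the
Mittag-Leffler function written as a `tsum`. -/
theorem stmt_3 (N : ℕ) (hN : 1 ≤ N) (α ν πA ρ Λ τ T : ℝ)
    (hα0 : 0 < α) (hα1 : α < 1) (hν0 : 0 ≤ ν) (hν1 : ν < 1/2) (hπA : 0 < πA) (hρ : 0 < ρ)
    (t : ℕ → ℝ) (ht0 : t 0 = 0) (htN : t N = T)
    (htmono : ∀ k : ℕ, 1 ≤ k → k ≤ N → t (k-1) < t k)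
    (A P : ℕ → ℕ → ℝ)
    (hA1mono : ∀ n k : ℕ, 2 ≤ k → k ≤ n → n ≤ N → A n (k-1) ≤ A n (k-2) ∧ 0 < A n (k-1))
    (hA1first : ∀ n : ℕ, 2 ≤ n → n ≤ N → 0 ≤ (1 - 2*ν) * A n 0 - (1-ν) * A n 1)
    (hA1pos : ∀ n : ℕ, 1 ≤ n → n ≤ N → 0 < A n 0)
    (hA2 : ∀ n k : ℕ, 1 ≤ k → k ≤ n → n ≤ N →
      (1 / (πA * (t k - t (k-1)))) *
        ∫ s in (t (k-1))..(t k), (t n - s) ^ (-α) / Real.Gamma (1-α) ≤ A n (n-k))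
    (hA3 : ∀ k : ℕ, 1 ≤ k → k ≤ N - 1 → (t k - t (k-1)) / (t (k+1) - t k) ≤ ρ)
    (hP0 : ∀ n : ℕ, 1 ≤ n → n ≤ N → P n 0 = 1 / A n 0)
    (hPrec : ∀ n j : ℕ, 1 ≤ j → j + 1 ≤ n → n ≤ N →
      P n (n-j) = (1 / A j 0) *
        ∑ k ∈ Finset.Icc (j+1) n, (A k (k-j-1) - A k (k-j)) * P n (n-k))
    (g lam : ℕ → ℝ)
    (hg : ∀ n : ℕ, 1 ≤ n → n ≤ N → 0 ≤ g n)
    (hlam : ∀ l : ℕ, l ≤ N - 1 → 0 ≤ lam l)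
    (hΛ : ∑ l ∈ Finset.range N, lam l ≤ Λ)
    (hτ : ∀ k : ℕ, 1 ≤ k → k ≤ N → t k - t (k-1) ≤ τ)
    (hτbound : τ ≤ (2 * πA * Real.Gamma (2-α) * Λ) ^ (-(1:ℝ)/α))
    (v : ℕ → ℝ) (hv : ∀ k : ℕ, k ≤ N → 0 ≤ v k)
    (hineq : ∀ n : ℕ, 1 ≤ n → n ≤ N →
      ∑ k ∈ Finset.Icc 1 n, A n (n-k) * (v k - v (k-1)) ≤
        ∑ k ∈ Finset.Icc 1 n, lam (n-k) * (ν * v (k-1) + (1-ν) * v k) + g n)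
    (n : ℕ) (hn1 : 1 ≤ n) (hnN : n ≤ N) :
    v n ≤ 2 * (∑' i : ℕ, (2 * max 1 ρ * πA * Λ * t n ^ α) ^ i / Real.Gamma (1 + (i:ℝ) * α)) *
        (v 0 + (Finset.Icc 1 n).sup' (Finset.nonempty_Icc.mpr hn1)
          (fun k => ∑ j ∈ Finset.Icc 1 k, P k (k-j) * g j)) ∧
      2 * (∑' i : ℕ, (2 * max 1 ρ * πA * Λ * t n ^ α) ^ i / Real.Gamma (1 + (i:ℝ) * α)) *
        (v 0 + (Finset.Icc 1 n).sup' (Finset.nonempty_Icc.mpr hn1)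
          (fun k => ∑ j ∈ Finset.Icc 1 k, P k (k-j) * g j))
      ≤ 2 * (∑' i : ℕ, (2 * max 1 ρ * πA * Λ * t n ^ α) ^ i / Real.Gamma (1 + (i:ℝ) * α)) *
        (v 0 + πA * Real.Gamma (1-α) *
          (Finset.Icc 1 n).sup' (Finset.nonempty_Icc.mpr hn1) (fun k => t k ^ α * g k)) := by
  have htm : ∀ i j : ℕ, i < j → j ≤ N → t i < t j := by
    intro i j hij
    induction j with
    | zero => omega
    | succ j ih =>
      intro hj
      have h1 := htmono (j+1) (by omega) hj
      rw [Nat.add_sub_cancel] at h1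
      rcases Nat.lt_succ_iff_lt_or_eq.1 hij with h | h
      · exact (ih h (by omega)).trans h1
      · rw [h]; exact h1
  have htp : ∀ k, 1 ≤ k → k ≤ N → 0 < t k := by
    intro k hk hkN
    have := htm 0 k hk hkN
    linarith
  have htn : ∀ k, k ≤ N → 0 ≤ t k := by
    intro k hk
    rcases Nat.eq_zero_or_pos k with h | h
    · rw [h, ht0]
    · exact (htp k h hk).le
  have hg1 := Real.Gamma_pos_of_pos (sub_pos.2 hα1)
  have hg2 : Real.Gamma (2 - α) = (1 - α) * Real.Gamma (1 - α) := by
    rw [show 2 - α = (1 - α) + 1 by ring, Real.Gamma_add_one (by linarith)]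
  have hg2p : 0 < Real.Gamma (2 - α) := Real.Gamma_pos_of_pos (by linarith)
  have hΛn : 0 ≤ Λ := le_trans (Finset.sum_nonneg (fun l hl => hlam l (by
    rw [Finset.mem_range] at hl; omega))) hΛ
  have hτp : 0 < τ := by
    have h1 := htmono 1 le_rfl hN
    have h2 := hτ 1 le_rfl hN
    linarith
  have hΛ0 : 0 < Λ := by
    rcases hΛn.eq_or_lt with h | h
    · rw [← h, mul_zero, Real.zero_rpow (by
        rw [neg_div]; exact neg_ne_zero.2 (one_div_pos.2 hα0).ne')] at hτbound
      linarith
    · exact h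
  have hA2' : ∀ n k : ℕ, 1 ≤ k → k ≤ n → n ≤ N →
      (∫ s in (t (k-1))..(t k), (t n - s) ^ (-α)) ≤
        πA * Real.Gamma (1-α) * (t k - t (k-1)) * A n (n-k) := by
    intro n k hk hkn hn
    have h := hA2 n k hk hkn hn
    have hd := sub_pos.2 (htmono k hk (by omega))
    rw [intervalIntegral.integral_div, one_div, inv_mul_le_iff₀ (by positivity), div_le_iff₀ hg1] at h
    linarith
  have hAnn : ∀ j k : ℕ, 1 ≤ k → k ≤ j → j ≤ N → 0 ≤ A j (j-k) := by
    intro j k hk hkj hj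
    rcases hkj.eq_or_lt with h | h
    · rw [h, Nat.sub_self]; exact (hA1pos j (by omega) hj).le
    · have := (hA1mono j (j-k+1) (by omega) (by omega) hj).2
      rw [Nat.add_sub_cancel] at this
      exact this.le
  have hP := fun n hn => aux_P_nonneg N A P hA1mono hA1pos hP0 hPrec n hn
  have hid : ∀ n, n ≤ N → ∀ k, 1 ≤ k → k ≤ n →
      ∑ j ∈ Finset.Icc k n, P n (n-j) * A j (j-k) = 1 := by
    intro n hn k hk hkn
    have := aux_P_id N A P hA1pos hP0 hPrec n hn (n-k) (by omega)
    rwa [show n - (n-k) = k by omega] at this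
  have hA3' : ∀ k : ℕ, 1 ≤ k → k ≤ N - 1 → (t k - t (k-1)) ≤ ρ * (t (k+1) - t k) := by
    intro k hk hkN
    have h := hA3 k hk hkN
    have := htm k (k+1) (by omega) (by omega)
    rwa [div_le_iff₀ (by linarith)] at h
  have hA0 : ∀ n, 1 ≤ n → n ≤ N → 2 * Λ ≤ A n 0 := by
    intro n hn hnN
    have h := hA2' n n hn le_rfl hnN
    have hd := sub_pos.2 (htmono n hn hnN)
    have e : ∫ s in (t (n-1))..(t n), (t n - s) ^ (-α) = (t n - t (n-1)) ^ (1-α) / (1 - α) := by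
      rw [intervalIntegral.integral_comp_sub_left (fun x => x ^ (-α)), integral_rpow (Or.inl (by linarith)),
        sub_self, show -α + 1 = 1 - α by ring, Real.zero_rpow (by linarith), sub_zero]
    rw [e, Nat.sub_self, div_le_iff₀ (by linarith)] at h
    set d := t n - t (n-1) with hdd
    have h2 : d ^ (1 - α) = d * d ^ (-α) := by
      rw [show 1 - α = 1 + (-α) by ring, Real.rpow_add hd, Real.rpow_one]
    have h3 : d ^ (-α) ≤ πA * Real.Gamma (2-α) * A n 0 := by
      rw [← mul_le_mul_iff_right₀ hd, ← h2, hg2]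
      linarith
    have hX : 0 < 2 * πA * Real.Gamma (2-α) * Λ := by positivity
    have h4 := Real.rpow_le_rpow_of_nonpos hd ((hτ n hn hnN).trans hτbound) (show -α ≤ 0 by linarith)
    rw [← Real.rpow_mul hX.le, show -(1:ℝ)/α * -α = 1 by field_simp, Real.rpow_one] at h4
    have h5 := h4.trans h3
    rw [← mul_le_mul_iff_right₀ (show 0 < πA * Real.Gamma (2-α) by positivity)]
    linarith
  set μ := 2 * max 1 ρ * πA * Λ with hμ
  have hμ0 : 0 < μ := by positivity
  set E : ℕ → ℝ := fun k => ∑' i : ℕ, (μ * t k ^ α) ^ i / Real.Gamma (1 + (i:ℝ) * α) with hEdef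
  have hΓi : ∀ i : ℕ, 0 < Real.Gamma (1 + (i:ℝ) * α) := fun i => Real.Gamma_pos_of_pos (by positivity)
  have hsum : ∀ k, Summable (fun i : ℕ => (μ * t k ^ α) ^ i / Real.Gamma (1 + (i:ℝ) * α)) :=
    fun k => aux_ml_summable α _ hα0
  have hsplit : ∀ k, E k = 1 + ∑' i : ℕ, (μ * t k ^ α) ^ (i+1) / Real.Gamma (1 + ((i+1 : ℕ):ℝ) * α) := by
    intro k
    simp only [hEdef]
    rw [(hsum k).tsum_eq_zero_add]
    simp
  have hE1 : ∀ k, k ≤ N → 1 ≤ E k := by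
    intro k hk
    rw [hsplit]
    have : 0 ≤ ∑' i : ℕ, (μ * t k ^ α) ^ (i+1) / Real.Gamma (1 + ((i+1 : ℕ):ℝ) * α) := by
      apply tsum_nonneg
      intro i
      have := hΓi (i+1)
      have := Real.rpow_nonneg (htn k hk) α
      positivity
    linarith
  have hEm : ∀ i j, i ≤ j → j ≤ N → E i ≤ E j := by
    intro i j hij hj
    apply Summable.tsum_le_tsum _ (hsum i) (hsum j)
    intro q
    have h0 := Real.rpow_nonneg (htn i (by omega)) α
    have h1 : t i ≤ t j := by
      rcases hij.eq_or_lt with h | h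
      · rw [h]
      · exact (htm i j h hj).le
    have h2 := Real.rpow_le_rpow (htn i (by omega)) h1 hα0.le
    have := hΓi q
    gcongr
  have hE : ∀ m, m + 1 ≤ N → 2 * Λ * ∑ j ∈ Finset.Icc 1 m, P (m+1) (m+1-j) * E j ≤ E (m+1) - 1 := by
    intro m hm
    have h1 : 2 * Λ * ∑ j ∈ Finset.Icc 1 m, P (m+1) (m+1-j) * E j =
        ∑' i : ℕ, ∑ j ∈ Finset.Icc 1 m, 2 * Λ * (P (m+1) (m+1-j) * ((μ * t j ^ α) ^ i / Real.Gamma (1 + (i:ℝ) * α))) := by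
      rw [Summable.tsum_finsetSum (fun j _ => ((hsum j).mul_left _).mul_left _), Finset.mul_sum]
      apply Finset.sum_congr rfl
      intro j _
      rw [tsum_mul_left, tsum_mul_left]
    rw [h1, hsplit, add_sub_cancel_left]
    apply Summable.tsum_le_tsum
    · intro i
      have hk := aux_key N α πA ρ (((i+1 : ℕ):ℝ) * α) hα0 hα1 (by positivity) hπA t ht0 htm A P hAnn hA2' hA3'
        m hm (hP _ hm) (hid _ hm)
      have e1 : ((i+1 : ℕ):ℝ) * α - α = i * α := by push_cast; ring
      have e2 : 1 + ((i+1 : ℕ):ℝ) * α - α = 1 + i * α := by push_cast; ring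
      rw [e1, e2] at hk
      have epow : ∀ (x : ℝ) (q : ℕ), 0 ≤ x → x ^ ((q:ℝ) * α) = (x ^ α) ^ q := by
        intro x q hx
        rw [mul_comm, Real.rpow_mul hx, Real.rpow_natCast]
      rw [epow _ _ (htn _ hm)] at hk
      have hk2 := mul_le_mul_of_nonneg_left hk (show 0 ≤ 2 * Λ * μ ^ i by positivity)
      refine le_trans (le_of_eq ?_) (hk2.trans (le_of_eq ?_))
      · rw [Finset.mul_sum]
        apply Finset.sum_congr rfl
        intro j hj
        rw [Finset.mem_Icc] at hj
        rw [epow _ _ (htn j (by omega)), mul_pow]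
        ring
      · rw [mul_pow μ (t (m+1) ^ α) (i+1), pow_succ μ i]
        have hμ' : 2 * Λ * (πA * max 1 ρ) = μ := by rw [hμ]; ring
        linear_combination (μ ^ i * ((t (m + 1) ^ α) ^ (i + 1) / Real.Gamma (1 + ((i + 1 : ℕ):ℝ) * α))) * hμ'
    · exact summable_sum (fun j _ => ((hsum j).mul_left _).mul_left _)
    · exact (summable_nat_add_iff 1).2 (hsum (m+1))
  have hne : (Finset.Icc 1 n).Nonempty := Finset.nonempty_Icc.mpr hn1
  have hle : ∀ k, 1 ≤ k → k ≤ n → ∑ j ∈ Finset.Icc 1 k, P k (k-j) * g j ≤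
      (Finset.Icc 1 n).sup' hne (fun k => ∑ j ∈ Finset.Icc 1 k, P k (k-j) * g j) := by
    intro k h1 h2
    exact Finset.le_sup' (fun k => ∑ j ∈ Finset.Icc 1 k, P k (k-j) * g j) (Finset.mem_Icc.2 ⟨h1, h2⟩)
  have hle2 : ∀ k, 1 ≤ k → k ≤ n → t k ^ α * g k ≤
      (Finset.Icc 1 n).sup' hne (fun k => t k ^ α * g k) := by
    intro k h1 h2
    exact Finset.le_sup' (fun k => t k ^ α * g k) (Finset.mem_Icc.2 ⟨h1, h2⟩)
  constructor
  · have hS0 : 0 ≤ (Finset.Icc 1 n).sup' hne (fun k => ∑ j ∈ Finset.Icc 1 k, P k (k-j) * g j) := by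
      refine le_trans ?_ (hle n hn1 le_rfl)
      apply Finset.sum_nonneg
      intro j hj
      rw [Finset.mem_Icc] at hj
      exact mul_nonneg (hP n hnN _ (by omega)) (hg j hj.1 (by omega))
    exact aux_gron N ν Λ hν0 hν1 hΛ0 A P E g lam v hA0 hP0 hP hid hE1 hEm hE hlam hΛ hv hineq _
      (by linarith) n hnN (fun k h1 h2 => by linarith [hle k h1 h2])
  · have hEn := hE1 n hnN
    apply mul_le_mul_of_nonneg_left _ (show 0 ≤ 2 * E n by linarith)
    apply add_le_add_right
    apply Finset.sup'_le
    intro k hk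
    rw [Finset.mem_Icc] at hk
    set M := (Finset.Icc 1 n).sup' hne (fun k => t k ^ α * g k) with hM
    have hM0 : 0 ≤ M := le_trans (mul_nonneg (Real.rpow_nonneg (htn n hnN) _) (hg n hn1 hnN)) (hle2 n hn1 le_rfl)
    have hA1 : ∀ j, 1 ≤ j → j ≤ N → t j ^ (-α) ≤ πA * Real.Gamma (1-α) * A j (j-1) := by
      intro j hj hjN
      have h := hA2' j 1 le_rfl hj hjN
      rw [Nat.sub_self, ht0, sub_zero] at h
      have ht1 := htp 1 le_rfl hN
      have hle1 : t 1 ≤ t j := by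
        rcases hj.eq_or_lt with h | h
        · rw [h]
        · exact (htm 1 j h hjN).le
      have h2 : ∫ s in (0:ℝ)..(t 1), t j ^ (-α) ≤ ∫ s in (0:ℝ)..(t 1), (t j - s) ^ (-α) := by
        apply intervalIntegral.integral_mono_on_of_le_Ioo ht1.le intervalIntegrable_const (aux_w_int α _ _ _ hα1)
        intro x hx
        exact Real.rpow_le_rpow_of_nonpos (by linarith [hx.2]) (by linarith [hx.1]) (by linarith)
      rw [intervalIntegral.integral_const, smul_eq_mul, sub_zero] at h2
      rw [← mul_le_mul_iff_right₀ ht1]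
      linarith
    calc ∑ j ∈ Finset.Icc 1 k, P k (k-j) * g j
        ≤ ∑ j ∈ Finset.Icc 1 k, πA * Real.Gamma (1-α) * M * (P k (k-j) * A j (j-1)) := by
          apply Finset.sum_le_sum
          intro j hj
          rw [Finset.mem_Icc] at hj
          have htj := htp j hj.1 (by omega)
          have h1 : g j ≤ πA * Real.Gamma (1-α) * A j (j-1) * M := by
            have h2 : g j = t j ^ (-α) * (t j ^ α * g j) := by
              rw [← mul_assoc, ← Real.rpow_add htj]; simp
            rw [h2]
            exact mul_le_mul (hA1 j hj.1 (by omega)) (hle2 j hj.1 (by omega))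
              (mul_nonneg (Real.rpow_nonneg htj.le _) (hg j hj.1 (by omega)))
              (mul_nonneg (by positivity) (hAnn j 1 le_rfl hj.1 (by omega)))
          have h3 := mul_le_mul_of_nonneg_left h1 (hP k (by omega) (k-j) (by omega))
          linarith
      _ = πA * Real.Gamma (1-α) * M := by
          rw [← Finset.mul_sum, hid k (by omega) 1 le_rfl hk.1, mul_one]
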